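/- arXiv:2403.12397 — 4 statements merged into one kernel-verified Lean document; each statement's English description precedes it below -/
import Mathlib

section
/- Let G be a subgroup of SL(2,ℂ) generated by elements g₁, …, gₙ. Then the smallest subfield of ℂ containing the traces of all elements of G is equal to the smallest subfield of ℂ containing the traces of the elements of the finite set {g_i, g_i·g_j, g_i·g_j·g_k : 1 ≤ i ≤ j ≤ k ≤ n}. -/
/-- The trace of an element of `SL(2, ℂ)`, viewed as a complex number. -/
noncomputable def SL2CTrace (m : Matrix.SpecialLinearGroup (Fin 2) ℂ) : ℂ :=
  Matrix.trace (m : Matrix (Fin 2) (Fin 2) ℂ)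

namespace Matrix

variable {F ι : Type*} [Field F]

/-- The span of `1`, the `X i` and the products `X i * X j` over a subfield. -/
def shortProductSpan (K : Subfield F) (X : ι → Matrix (Fin 2) (Fin 2) F) :
    Submodule K (Matrix (Fin 2) (Fin 2) F) :=
  Submodule.span K ({1} ∪ Set.range X ∪ Set.range fun p : ι × ι => X p.1 * X p.2)

private theorem apply_one_one_of_trace_eq_zero {x : Matrix (Fin 2) (Fin 2) F}
    (hx : x.trace = 0) : x 1 1 = -x 0 0 := by
  rw [trace_fin_two] at hx
  linear_combination hx

theorem two_smul_mul_mul_of_trace_eq_zero {x y z : Matrix (Fin 2) (Fin 2) F}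
    (hx : x.trace = 0) (hy : y.trace = 0) (hz : z.trace = 0) :
    (2 : F) • (x * y * z) = (x * y).trace • z - (x * z).trace • y + (y * z).trace • x +
      (x * y * z).trace • (1 : Matrix (Fin 2) (Fin 2) F) := by
  have hx' := apply_one_one_of_trace_eq_zero hx
  have hy' := apply_one_one_of_trace_eq_zero hy
  have hz' := apply_one_one_of_trace_eq_zero hz
  ext i j
  fin_cases i <;> fin_cases j <;>
    simp [trace_fin_two, mul_apply, Fin.sum_univ_two, hx', hy', hz'] <;> ring

theorem trace_mul_mul_swap_of_trace_eq_zero {x y z : Matrix (Fin 2) (Fin 2) F}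
    (hx : x.trace = 0) (hy : y.trace = 0) (hz : z.trace = 0) :
    (x * z * y).trace = -(x * y * z).trace := by
  have hx' := apply_one_one_of_trace_eq_zero hx
  have hy' := apply_one_one_of_trace_eq_zero hy
  have hz' := apply_one_one_of_trace_eq_zero hz
  simp only [trace_fin_two, mul_apply, Fin.sum_univ_two, hx', hy', hz']
  ring

theorem mul_mem_shortProductSpan [NeZero (2 : F)] {K : Subfield F}
    {X : ι → Matrix (Fin 2) (Fin 2) F} (h₁ : ∀ i, (X i).trace = 0)
    (h₂ : ∀ i j, (X i * X j).trace ∈ K) (h₃ : ∀ i j k, (X i * X j * X k).trace ∈ K)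
    {v : Matrix (Fin 2) (Fin 2) F} (hv : v ∈ shortProductSpan K X) (k : ι) :
    v * X k ∈ shortProductSpan K X := by
  have one_mem : 1 ∈ shortProductSpan K X := Submodule.subset_span (by simp)
  have mem (i) : X i ∈ shortProductSpan K X := Submodule.subset_span (by simp)
  have smul_mem {c : F} (hc : c ∈ K) {w} (hw : w ∈ shortProductSpan K X) :
      c • w ∈ shortProductSpan K X := Submodule.smul_mem _ (⟨c, hc⟩ : K) hw
  induction hv using Submodule.span_induction with
  | mem w hw =>
    obtain (rfl | ⟨i, rfl⟩) | ⟨⟨i, j⟩, rfl⟩ := hw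
    · simpa using mem k
    · exact Submodule.subset_span (Or.inr ⟨(i, k), rfl⟩)
    · have hprod := two_smul_mul_mul_of_trace_eq_zero (h₁ i) (h₁ j) (h₁ k)
      rw [← eq_inv_smul_iff₀ (NeZero.ne (2 : F))] at hprod
      change X i * X j * X k ∈ _
      rw [hprod]
      refine smul_mem (inv_mem (ofNat_mem K 2)) (add_mem (add_mem (sub_mem ?_ ?_) ?_) ?_)
      · exact smul_mem (h₂ i j) (mem k)
      · exact smul_mem (h₂ i k) (mem j)
      · exact smul_mem (h₂ j k) (mem i)
      · exact smul_mem (h₃ i j k) one_mem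
  | zero => simp
  | add x y _ _ hx hy => rw [add_mul]; exact add_mem hx hy
  | smul c x _ hx => rw [smul_mul_assoc]; exact Submodule.smul_mem _ c hx

theorem trace_mem_of_mem_shortProductSpan {K : Subfield F}
    {X : ι → Matrix (Fin 2) (Fin 2) F} (h₁ : ∀ i, (X i).trace = 0)
    (h₂ : ∀ i j, (X i * X j).trace ∈ K)
    {v : Matrix (Fin 2) (Fin 2) F} (hv : v ∈ shortProductSpan K X) : v.trace ∈ K := by
  induction hv using Submodule.span_induction with
  | mem w hw =>
    obtain (rfl | ⟨i, rfl⟩) | ⟨⟨i, j⟩, rfl⟩ := hw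
    · simp
    · rw [h₁ i]; exact zero_mem K
    · exact h₂ i j
  | zero => simp
  | add x y _ _ hx hy => rw [trace_add]; exact add_mem hx hy
  | smul c x _ hx => rw [trace_smul]; exact mul_mem c.2 hx

/-- Over a linear order, the triple traces of trace-zero matrices in increasing order determine
all of them up to sign. -/
theorem trace_mul_mul_mem_of_forall_le [LinearOrder ι] {K : Subfield F}
    {X : ι → Matrix (Fin 2) (Fin 2) F} (h₁ : ∀ i, (X i).trace = 0)
    (h : ∀ i j k, i ≤ j → j ≤ k → (X i * X j * X k).trace ∈ K) (i j k : ι) :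
    (X i * X j * X k).trace ∈ K := by
  have swap {i j k} (hijk : (X i * X j * X k).trace ∈ K) : (X i * X k * X j).trace ∈ K := by
    rw [trace_mul_mul_swap_of_trace_eq_zero (h₁ i) (h₁ j) (h₁ k)]
    exact neg_mem hijk
  have rotate {i j k} (hijk : (X i * X j * X k).trace ∈ K) : (X k * X i * X j).trace ∈ K := by
    rwa [← trace_mul_cycle]
  rcases le_total i j with hij | hij <;> rcases le_total j k with hjk | hjk <;>
    rcases le_total i k with hik | hik
  · exact h _ _ _ hij hjk
  · exact h _ _ _ hij hjk
  · exact swap (h _ _ _ hik hjk)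
  · exact rotate (rotate (h _ _ _ hik hij))
  · exact swap (rotate (rotate (h _ _ _ hij hik)))
  · exact rotate (h _ _ _ hjk hik)
  · exact rotate (rotate (swap (h _ _ _ hjk hij)))
  · exact rotate (rotate (swap (h _ _ _ hjk hij)))

/-- The trace-zero part of a `2 × 2` matrix. -/
def traceless (A : Matrix (Fin 2) (Fin 2) F) : Matrix (Fin 2) (Fin 2) F :=
  A - (A.trace / 2) • (1 : Matrix (Fin 2) (Fin 2) F)

theorem trace_traceless [NeZero (2 : F)] (A : Matrix (Fin 2) (Fin 2) F) :
    (traceless A).trace = 0 := by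
  have := NeZero.ne (2 : F)
  simp [traceless, this]

theorem trace_traceless_mul [NeZero (2 : F)] (A B : Matrix (Fin 2) (Fin 2) F) :
    (traceless A * traceless B).trace = (A * B).trace - A.trace * B.trace / 2 := by
  have := NeZero.ne (2 : F)
  simp [traceless, sub_mul, mul_sub]
  field

theorem trace_traceless_mul_mul [NeZero (2 : F)] (A B C : Matrix (Fin 2) (Fin 2) F) :
    (traceless A * traceless B * traceless C).trace =
      (A * B * C).trace - ((A * B).trace * C.trace + (A * C).trace * B.trace +
        (B * C).trace * A.trace) / 2 + A.trace * B.trace * C.trace / 2 := by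
  have := NeZero.ne (2 : F)
  simp [traceless, sub_mul, mul_sub]
  field

/-- If the traces of the increasing products of length at most three of `g` lie in a subfield `K`,
so do the traces of all elements of the subgroup generated by `g`. -/
theorem SpecialLinearGroup.trace_mem_of_mem_closure [NeZero (2 : F)] [LinearOrder ι]
    {K : Subfield F} {g : ι → SpecialLinearGroup (Fin 2) F}
    (h₁ : ∀ i, (g i).1.trace ∈ K)
    (h₂ : ∀ i j, i ≤ j → ((g i).1 * (g j).1).trace ∈ K)
    (h₃ : ∀ i j k, i ≤ j → j ≤ k → ((g i).1 * (g j).1 * (g k).1).trace ∈ K)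
    {m : SpecialLinearGroup (Fin 2) F} (hm : m ∈ Subgroup.closure (Set.range g)) :
    m.1.trace ∈ K := by
  have two_mem : (2 : F) ∈ K := ofNat_mem K 2
  let X i := traceless (g i).1
  have hX₁ i : (X i).trace = 0 := trace_traceless _
  have hX₂ i j : (X i * X j).trace ∈ K := by
    rw [trace_traceless_mul]
    refine sub_mem ?_ (div_mem (mul_mem (h₁ i) (h₁ j)) two_mem)
    rcases le_total i j with hij | hij
    · exact h₂ i j hij
    · rw [trace_mul_comm]
      exact h₂ j i hij
  have hX₃ : ∀ i j k, (X i * X j * X k).trace ∈ K := by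
    refine trace_mul_mul_mem_of_forall_le hX₁ fun i j k hij hjk => ?_
    rw [trace_traceless_mul_mul]
    exact add_mem (sub_mem (h₃ i j k hij hjk) (div_mem (add_mem (add_mem
      (mul_mem (h₂ i j hij) (h₁ k)) (mul_mem (h₂ i k (hij.trans hjk)) (h₁ j)))
      (mul_mem (h₂ j k hjk) (h₁ i))) two_mem))
      (div_mem (mul_mem (mul_mem (h₁ i) (h₁ j)) (h₁ k)) two_mem)
  have hg i : (g i).1 = X i + ((g i).1.trace / 2) • 1 := by simp [X, traceless]
  have smul_mem {c : F} (hc : c ∈ K) {w} (hw : w ∈ shortProductSpan K X) :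
      c • w ∈ shortProductSpan K X := Submodule.smul_mem _ (⟨c, hc⟩ : K) hw
  have mul_gen {v} (hv : v ∈ shortProductSpan K X) (i) :
      v * (g i).1 ∈ shortProductSpan K X := by
    rw [hg, mul_add, mul_smul_comm, mul_one]
    exact add_mem (mul_mem_shortProductSpan hX₁ hX₂ hX₃ hv i)
      (smul_mem (div_mem (h₁ i) two_mem) hv)
  refine trace_mem_of_mem_shortProductSpan hX₁ hX₂ ?_
  induction hm using Subgroup.closure_induction_right with
  | one => exact Submodule.subset_span (by simp)
  | mul_right x hx y hy ih =>
    obtain ⟨i, rfl⟩ := hy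
    exact mul_gen ih i
  | mul_inv_cancel x hx y hy ih =>
    obtain ⟨i, rfl⟩ := hy
    have hinv : (g i)⁻¹.1 = (g i).1.trace • 1 - (g i).1 := by
      rw [SpecialLinearGroup.coe_inv, adjugate_fin_two]
      ext a b
      fin_cases a <;> fin_cases b <;> simp [trace_fin_two]
    change x.1 * (g i)⁻¹.1 ∈ _
    rw [hinv, mul_sub, mul_smul_comm, mul_one]
    exact sub_mem (smul_mem (h₁ i) ih) (mul_gen ih i)

end Matrix

/-- Maclachlan–Reid, Lemma 3.5.3: if `G ≤ SL(2, ℂ)` is generated by `g₁, …, gₙ`, then the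
smallest subfield of `ℂ` containing the traces of all elements of `G` equals the smallest
subfield of `ℂ` containing the traces of the elements
`{gᵢ, gᵢgⱼ, gᵢgⱼg_k : 1 ≤ i ≤ j ≤ k ≤ n}`. -/
theorem trace_field_generated_by_traces_of_short_products
    (n : ℕ) (g : Fin n → Matrix.SpecialLinearGroup (Fin 2) ℂ)
    (G : Subgroup (Matrix.SpecialLinearGroup (Fin 2) ℂ))
    (hG : G = Subgroup.closure (Set.range g)) :
    Subfield.closure (SL2CTrace '' (G : Set (Matrix.SpecialLinearGroup (Fin 2) ℂ))) =
      Subfield.closure (SL2CTrace ''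
        ({m | ∃ i, m = g i} ∪
         {m | ∃ i j, i ≤ j ∧ m = g i * g j} ∪
         {m | ∃ i j k, i ≤ j ∧ j ≤ k ∧ m = g i * g j * g k})) := by
  subst hG
  apply le_antisymm
  · rw [Subfield.closure_le]
    rintro _ ⟨m, hm, rfl⟩
    refine Matrix.SpecialLinearGroup.trace_mem_of_mem_closure (fun i => ?_) (fun i j hij => ?_)
      (fun i j k hij hjk => ?_) hm
    · exact Subfield.subset_closure ⟨g i, .inl (.inl ⟨i, rfl⟩), rfl⟩
    · exact Subfield.subset_closure ⟨g i * g j, .inl (.inr ⟨i, j, hij, rfl⟩), rfl⟩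
    · exact Subfield.subset_closure ⟨g i * g j * g k, .inr ⟨i, j, k, hij, hjk, rfl⟩, rfl⟩
  · refine Subfield.closure_mono (Set.image_mono ?_)
    have mem i : g i ∈ Subgroup.closure (Set.range g) := Subgroup.subset_closure ⟨i, rfl⟩
    rintro _ ((⟨i, rfl⟩ | ⟨i, j, -, rfl⟩) | ⟨i, j, k, -, -, rfl⟩)
    · exact mem i
    · exact mul_mem (mem i) (mem j)
    · exact mul_mem (mul_mem (mem i) (mem j)) (mem k)
end

section
/- Let G be a subgroup of SL(2,ℂ) generated by elements g₁, …, gₙ. Then every element of G has real trace if and only if every element of the finite set {g_i, g_i·g_j, g_i·g_j·g_k : 1 ≤ i ≤ j ≤ k ≤ n} has real trace. -/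
namespace Matrix

variable {R : Type*} [CommRing R]

theorem trace_mul_mul_add_trace_mul_mul_swap (x y z : Matrix (Fin 2) (Fin 2) R) :
    trace (x * y * z) + trace (x * z * y) =
      trace x * trace (y * z) + trace y * trace (x * z) + trace z * trace (x * y)
        - trace x * trace y * trace z := by
  simp only [trace_fin_two, mul_apply, Fin.sum_univ_two]
  ring

/-- Twice a product of three `2 × 2` matrices is a combination of shorter products, with
coefficients that are polynomials in traces of products of length at most three. -/
theorem two_smul_mul_mul_eq (x y z : Matrix (Fin 2) (Fin 2) R) :
    (2 : R) • (x * y * z) =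
      trace z • (x * y) + trace y • (x * z) + trace x • (y * z)
        + (trace (y * z) - trace y * trace z) • x - trace (x * z) • y
        + (trace (x * y) - trace x * trace y) • z
        + (trace (x * y * z) + trace x * trace y * trace z
            - trace x * trace (y * z) - trace z * trace (x * y)) • 1 := by
  ext i j
  fin_cases i <;> fin_cases j <;>
    simp [trace_fin_two, mul_apply, Fin.sum_univ_two] <;> ring

end Matrix

section RealTraces

open Matrix

variable {ι : Type*}

/-- The real span of the products of at most two members of a family of matrices. -/
noncomputable def realSpanShortProducts (x : ι → Matrix (Fin 2) (Fin 2) ℂ) :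
    Submodule ℝ (Matrix (Fin 2) (Fin 2) ℂ) :=
  Submodule.span ℝ ({1} ∪ Set.range x ∪ Set.range fun p : ι × ι => x p.1 * x p.2)

theorem one_mem_realSpanShortProducts (x : ι → Matrix (Fin 2) (Fin 2) ℂ) :
    1 ∈ realSpanShortProducts x :=
  Submodule.subset_span (Or.inl (Or.inl rfl))

theorem mem_realSpanShortProducts (x : ι → Matrix (Fin 2) (Fin 2) ℂ) (i : ι) :
    x i ∈ realSpanShortProducts x :=
  Submodule.subset_span (Or.inl (Or.inr ⟨i, rfl⟩))

theorem mul_mem_realSpanShortProducts (x : ι → Matrix (Fin 2) (Fin 2) ℂ) (i j : ι) :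
    x i * x j ∈ realSpanShortProducts x :=
  Submodule.subset_span (Or.inr ⟨(i, j), rfl⟩)

theorem Submodule.smul_mem_of_im_eq_zero {M : Type*} [AddCommGroup M] [Module ℂ M]
    (S : Submodule ℝ M) {c : ℂ} (hc : c.im = 0) {m : M} (hm : m ∈ S) : c • m ∈ S := by
  have hc' : c = (c.re : ℂ) := Complex.ext rfl (by simp [hc])
  rw [hc', Complex.coe_smul]
  exact S.smul_mem _ hm

theorem im_trace_eq_zero_of_mem_realSpanShortProducts {x : ι → Matrix (Fin 2) (Fin 2) ℂ}
    (h₁ : ∀ i, (trace (x i)).im = 0) (h₂ : ∀ i j, (trace (x i * x j)).im = 0)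
    {m : Matrix (Fin 2) (Fin 2) ℂ} (hm : m ∈ realSpanShortProducts x) :
    (trace m).im = 0 := by
  induction hm using Submodule.span_induction with
  | mem m hm =>
    rcases hm with (rfl | ⟨i, rfl⟩) | ⟨p, rfl⟩
    · simp
    · exact h₁ i
    · exact h₂ p.1 p.2
  | zero => simp
  | add a b _ _ ha hb => simp [trace_add, ha, hb]
  | smul r a _ ha => simp [trace_smul, ha]

theorem mul_mul_mem_realSpanShortProducts {x : ι → Matrix (Fin 2) (Fin 2) ℂ}
    (h₁ : ∀ i, (trace (x i)).im = 0) (h₂ : ∀ i j, (trace (x i * x j)).im = 0)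
    (h₃ : ∀ i j k, (trace (x i * x j * x k)).im = 0) (i j k : ι) :
    x i * x j * x k ∈ realSpanShortProducts x := by
  have key : (2 : ℂ) • (x i * x j * x k) ∈ realSpanShortProducts x := by
    rw [two_smul_mul_mul_eq]
    have hx := mem_realSpanShortProducts x
    have hxx := mul_mem_realSpanShortProducts x
    have h_one := one_mem_realSpanShortProducts x
    refine add_mem (add_mem (sub_mem (add_mem (add_mem (add_mem ?_ ?_) ?_) ?_) ?_) ?_) ?_ <;>
      refine Submodule.smul_mem_of_im_eq_zero _ ?_ (by first | apply hxx | apply hx | exact h_one)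
        <;>
      simp [h₁, h₂, h₃]
  have := Submodule.smul_mem_of_im_eq_zero _ (c := 2⁻¹) (by simp) key
  rwa [smul_smul, inv_mul_cancel₀ two_ne_zero, one_smul] at this

theorem mul_mem_realSpanShortProducts_of_mem {x : ι → Matrix (Fin 2) (Fin 2) ℂ}
    (h₁ : ∀ i, (trace (x i)).im = 0) (h₂ : ∀ i j, (trace (x i * x j)).im = 0)
    (h₃ : ∀ i j k, (trace (x i * x j * x k)).im = 0) (k : ι)
    {m : Matrix (Fin 2) (Fin 2) ℂ} (hm : m ∈ realSpanShortProducts x) :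
    m * x k ∈ realSpanShortProducts x := by
  induction hm using Submodule.span_induction with
  | mem m hm =>
    rcases hm with (rfl | ⟨i, rfl⟩) | ⟨p, rfl⟩
    · simpa using mem_realSpanShortProducts x k
    · exact mul_mem_realSpanShortProducts x i k
    · exact mul_mul_mem_realSpanShortProducts h₁ h₂ h₃ p.1 p.2 k
  | zero => simp
  | add a b _ _ ha hb => rw [add_mul]; exact add_mem ha hb
  | smul r a _ ha => rw [smul_mul_assoc]; exact Submodule.smul_mem _ r ha

theorem Matrix.SpecialLinearGroup.coe_inv_eq_trace_smul_sub {R : Type*} [CommRing R]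
    (m : SpecialLinearGroup (Fin 2) R) :
    ((m⁻¹ : SpecialLinearGroup (Fin 2) R) : Matrix (Fin 2) (Fin 2) R) =
      trace (m : Matrix (Fin 2) (Fin 2) R) • 1 - m := by
  rw [SpecialLinearGroup.coe_inv, adjugate_fin_two]
  ext i j
  fin_cases i <;> fin_cases j <;> simp [trace_fin_two]

/-- If the products of at most three generators, in any order, have real trace, then so has every
element of the group they generate. -/
theorem im_trace_eq_zero_of_mem_closure {g : ι → SpecialLinearGroup (Fin 2) ℂ}
    (h₁ : ∀ i, (trace (g i : Matrix (Fin 2) (Fin 2) ℂ)).im = 0)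
    (h₂ : ∀ i j, (trace (g i * g j : Matrix (Fin 2) (Fin 2) ℂ)).im = 0)
    (h₃ : ∀ i j k, (trace (g i * g j * g k : Matrix (Fin 2) (Fin 2) ℂ)).im = 0)
    {m : SpecialLinearGroup (Fin 2) ℂ} (hm : m ∈ Subgroup.closure (Set.range g)) :
    (trace (m : Matrix (Fin 2) (Fin 2) ℂ)).im = 0 := by
  set S := realSpanShortProducts fun i => (g i : Matrix (Fin 2) (Fin 2) ℂ)
  have h_tr {m : SpecialLinearGroup (Fin 2) ℂ}
      (hm : ∀ s ∈ S, s * (m : Matrix (Fin 2) (Fin 2) ℂ) ∈ S) :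
      (trace (m : Matrix (Fin 2) (Fin 2) ℂ)).im = 0 :=
    im_trace_eq_zero_of_mem_realSpanShortProducts h₁ h₂
      (by simpa using hm 1 (one_mem_realSpanShortProducts _))
  refine h_tr ?_
  induction hm using Subgroup.closure_induction with
  | mem m hm =>
    obtain ⟨k, rfl⟩ := hm
    exact fun s hs => mul_mem_realSpanShortProducts_of_mem h₁ h₂ h₃ k hs
  | one => simp
  | mul a b _ _ ha hb =>
    intro s hs
    change s * ((a : Matrix (Fin 2) (Fin 2) ℂ) * (b : Matrix (Fin 2) (Fin 2) ℂ)) ∈ S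
    rw [← mul_assoc]
    exact hb _ (ha s hs)
  | inv a _ ha =>
    intro s hs
    rw [SpecialLinearGroup.coe_inv_eq_trace_smul_sub, mul_sub, mul_smul_comm, mul_one]
    exact sub_mem (Submodule.smul_mem_of_im_eq_zero S (h_tr ha) hs) (ha s hs)

/-- If products of at most three matrices with weakly increasing indices have real trace, then so
have all products of three. -/
theorem im_trace_mul_mul_eq_zero_of_le [LinearOrder ι] {x : ι → Matrix (Fin 2) (Fin 2) ℂ}
    (h₁ : ∀ i, (trace (x i)).im = 0) (h₂ : ∀ i j, (trace (x i * x j)).im = 0)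
    (h₃ : ∀ i j k, i ≤ j → j ≤ k → (trace (x i * x j * x k)).im = 0) (i j k : ι) :
    (trace (x i * x j * x k)).im = 0 := by
  have h_swap (i j k : ι) (h : (trace (x i * x j * x k)).im = 0) :
      (trace (x i * x k * x j)).im = 0 := by
    have := congrArg Complex.im (trace_mul_mul_add_trace_mul_mul_swap (x i) (x j) (x k))
    simpa [h, h₁, h₂] using this
  have h_cycle (i j k : ι) (h : (trace (x i * x j * x k)).im = 0) :
      (trace (x j * x k * x i)).im = 0 := by
    rwa [trace_mul_cycle]
  rcases le_total i j with hij | hij <;> rcases le_total j k with hjk | hjk <;>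
    rcases le_total i k with hik | hik
  · exact h₃ i j k hij hjk
  · exact h₃ i j k hij hjk
  · exact h_swap _ _ _ (h₃ i k j hik hjk)
  · exact h_cycle _ _ _ (h₃ k i j hik hij)
  · exact h_swap _ _ _ (h_cycle _ _ _ (h₃ j i k hij hik))
  · exact h_cycle _ _ _ (h_cycle _ _ _ (h₃ j k i hjk hik))
  · exact h_cycle _ _ _ (h_swap _ _ _ (h₃ k j i hjk hij))
  · exact h_cycle _ _ _ (h_swap _ _ _ (h₃ k j i hjk hij))

end RealTraces

/-- If `G ≤ SL(2, ℂ)` is generated by `g₁, …, gₙ`, then every element of `G` has real trace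
if and only if every element of the finite set
`{gᵢ, gᵢgⱼ, gᵢgⱼg_k : 1 ≤ i ≤ j ≤ k ≤ n}` has real trace. -/
theorem all_traces_real_iff_short_products_real
    (n : ℕ) (g : Fin n → Matrix.SpecialLinearGroup (Fin 2) ℂ)
    (G : Subgroup (Matrix.SpecialLinearGroup (Fin 2) ℂ))
    (hG : G = Subgroup.closure (Set.range g)) :
    (∀ m ∈ G, (SL2CTrace m).im = 0) ↔
      (∀ m ∈ ({m | ∃ i, m = g i} ∪
              {m | ∃ i j, i ≤ j ∧ m = g i * g j} ∪
              {m | ∃ i j k, i ≤ j ∧ j ≤ k ∧ m = g i * g j * g k} :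
                Set (Matrix.SpecialLinearGroup (Fin 2) ℂ)),
        (SL2CTrace m).im = 0) := by
  subst hG
  constructor
  · intro h m hm
    have hg (i : Fin n) : g i ∈ Subgroup.closure (Set.range g) :=
      Subgroup.subset_closure ⟨i, rfl⟩
    refine h m ?_
    rcases hm with (⟨i, rfl⟩ | ⟨i, j, -, rfl⟩) | ⟨i, j, k, -, -, rfl⟩
    · exact hg i
    · exact mul_mem (hg i) (hg j)
    · exact mul_mem (mul_mem (hg i) (hg j)) (hg k)
  · intro h m hm
    have h₁ (i : Fin n) : (Matrix.trace (g i : Matrix (Fin 2) (Fin 2) ℂ)).im = 0 :=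
      h _ (Or.inl (Or.inl ⟨i, rfl⟩))
    have h₂ (i j : Fin n) : (Matrix.trace (g i * g j : Matrix (Fin 2) (Fin 2) ℂ)).im = 0 := by
      rcases le_total i j with hij | hij
      · exact h _ (Or.inl (Or.inr ⟨i, j, hij, rfl⟩))
      · rw [Matrix.trace_mul_comm]
        exact h _ (Or.inl (Or.inr ⟨j, i, hij, rfl⟩))
    exact im_trace_eq_zero_of_mem_closure h₁ h₂
      (im_trace_mul_mul_eq_zero_of_le h₁ h₂
        fun i j k hij hjk => h _ (Or.inr ⟨i, j, k, hij, hjk, rfl⟩)) hm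
end

section
/- Let G be a group and φ : G → SL(2,ℂ) a group homomorphism that is irreducible, meaning that no one-dimensional complex linear subspace of ℂ² is invariant under φ(g) for every g ∈ G. If tr(φ(g)) is a real number for every g ∈ G, then φ is conjugate into SU(2) or into SL(2,ℝ): there exists an invertible 2×2 complex matrix A such that either A·φ(g)·A⁻¹ is a unitary matrix for every g ∈ G, or A·φ(g)·A⁻¹ has all entries real for every g ∈ G. -/
section

open Matrix

/-- Two algebra homomorphisms to a full matrix algebra with the same trace, one of which is
surjective, are intertwined by an invertible matrix. -/
theorem AlgHom.exists_isUnit_intertwining_of_trace_eq {K A n : Type*} [Field K] [Ring A]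
    [Algebra K A] [Fintype n] [DecidableEq n] (F F' : A →ₐ[K] Matrix n n K)
    (hF : Function.Surjective F) (htr : ∀ a, (F a).trace = (F' a).trace) :
    ∃ P : Matrix n n K, IsUnit P ∧ ∀ a, P * F a = F' a * P := by
  have ker_of_surj : ∀ F₁ F₂ : A →ₐ[K] Matrix n n K, Function.Surjective F₁ →
      (∀ a, (F₁ a).trace = (F₂ a).trace) → ∀ a, F₂ a = 0 → F₁ a = 0 := by
    intro F₁ F₂ h₁ ht a ha
    rw [ext_iff_trace_mul_right]
    intro x
    obtain ⟨b, rfl⟩ := h₁ x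
    rw [← map_mul, ht, map_mul, ha, zero_mul, zero_mul]
  obtain ⟨s, hs⟩ := F.toLinearMap.exists_rightInverse_of_surjective (LinearMap.range_eq_top.2 hF)
  have hFs : ∀ x, F (s x) = x := fun x => congr($hs x)
  have hinj : Function.Injective (F'.toLinearMap ∘ₗ s) := by
    rw [injective_iff_map_eq_zero]
    intro x hx
    rw [← hFs x]
    exact ker_of_surj F F' hF htr _ hx
  have hsurj : Function.Surjective (F'.toLinearMap ∘ₗ s) :=
    LinearMap.injective_iff_surjective.1 hinj
  have hF' : Function.Surjective F' := fun y => (hsurj y).imp' s fun _ h => h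
  have key : ∀ a b, F a = F b → F' a = F' b := fun a b h => by
    rw [← sub_eq_zero, ← map_sub]
    exact ker_of_surj F' F hF' (fun a => (htr a).symm) _ (by rw [map_sub, h, sub_self])
  let e : Matrix n n K ≃ₐ[K] Matrix n n K :=
    AlgEquiv.ofLinearEquiv (LinearEquiv.ofBijective _ ⟨hinj, hsurj⟩)
      ((key (s 1) 1 (by simp [hFs])).trans (map_one F'))
      (fun x y => (key (s (x * y)) (s x * s y) (by simp [hFs])).trans (map_mul F' _ _))
  have he : ∀ a, e (F a) = F' a := fun a => key _ _ (hFs _)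
  obtain ⟨T, hT⟩ := ((toLinAlgEquiv'.symm.trans e).trans toLinAlgEquiv').eq_linearEquivConjAlgEquiv
  refine ⟨LinearMap.toMatrix' T.toLinearMap, ?_, fun a => ?_⟩
  · exact IsUnit.of_mul_eq_one (LinearMap.toMatrix' T.symm.toLinearMap) (by
      rw [← LinearMap.toMatrix'_comp]; simp)
  · have h := congr($hT (toLinAlgEquiv' (F a)))
    have h2 : toLinAlgEquiv' (F' a) = T.conj (toLinAlgEquiv' (F a)) := by
      rw [← he]
      simpa [LinearEquiv.conjAlgEquiv_apply, LinearEquiv.conj_apply, LinearMap.comp_assoc] using h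
    apply toLin'.injective
    ext1 i
    ext1
    have := congr($h2 (T (Pi.single i 1)))
    simp [LinearEquiv.conj_apply, -mulVec_single] at this
    simp [-mulVec_single, this]

/-- **Burnside's theorem**: the image of the group algebra under an irreducible finite-dimensional
representation over an algebraically closed field is the full endomorphism algebra. -/
theorem Representation.IsIrreducible.asAlgebraHom_surjective {G K V : Type*} [Monoid G] [Field K]
    [IsAlgClosed K] [AddCommGroup V] [Module K V] [FiniteDimensional K V]
    (ρ : Representation K G V) [ρ.IsIrreducible] : Function.Surjective ρ.asAlgebraHom := by
  intro M
  have hschur := (IsSimpleModule.algebraMap_end_bijective_of_isAlgClosed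
    (A := MonoidAlgebra K G) (V := ρ.asModule) K).2
  let f : Module.End (Module.End (MonoidAlgebra K G) ρ.asModule) ρ.asModule :=
    { toFun := fun v => ρ.asModuleEquiv.symm (M (ρ.asModuleEquiv v))
      map_add' := fun v w => by simp
      map_smul' := fun c v => by
        obtain ⟨c, rfl⟩ := hschur c
        simp }
  classical
  let b := Module.finBasis K V
  obtain ⟨a, ha⟩ := jacobson_density f (Finset.univ.image fun i => ρ.asModuleEquiv.symm (b i))
  refine ⟨a, b.ext fun i => ?_⟩
  have h := congr(ρ.asModuleEquiv $(ha (ρ.asModuleEquiv.symm (b i)) (by simp)))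
  rw [Representation.asModuleEquiv_map_smul] at h
  simpa [f] using h.symm

/-- A two-dimensional representation without invariant lines is irreducible. -/
theorem Representation.isIrreducible_of_finrank_eq_two {G K V : Type*} [Monoid G] [Field K]
    [AddCommGroup V] [Module K V] {ρ : Representation K G V} (hV : Module.finrank K V = 2)
    (hρ : ∀ W : Submodule K V, Module.finrank K W = 1 → ¬ ∀ x, ∀ v ∈ W, ρ x v ∈ W) :
    ρ.IsIrreducible := by
  have : Module.Finite K V := Module.finite_of_finrank_eq_succ hV
  have : Nontrivial V := Module.nontrivial_of_finrank_eq_succ hV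
  refine { exists_pair_ne := ⟨⊥, ⊤, fun h => ?_⟩, eq_bot_or_eq_top := fun W => ?_ }
  · exact bot_ne_top (α := Submodule K V) congr(($h).toSubmodule)
  have hle : Module.finrank K W.toSubmodule ≤ 2 := hV ▸ Submodule.finrank_le W.toSubmodule
  have hne : Module.finrank K W.toSubmodule ≠ 1 := fun h =>
    hρ W.toSubmodule h fun x v hv => W.apply_mem_toSubmodule x hv
  obtain h | h : Module.finrank K W.toSubmodule = 0 ∨ Module.finrank K W.toSubmodule = 2 := by
    omega
  · exact .inl <| Subrepresentation.toSubmodule_injective <|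
      Submodule.finrank_eq_zero.1 h
  · exact .inr <| Subrepresentation.toSubmodule_injective <|
      Submodule.eq_top_of_finrank_eq (h.trans hV.symm)

/-- **Sylvester's law of inertia** for invertible Hermitian matrices. -/
theorem Matrix.IsHermitian.exists_isUnit_conjTranspose_mul_diagonal_mul {n : Type*} [Fintype n]
    [DecidableEq n] {H : Matrix n n ℂ} (hH : H.IsHermitian) (hu : IsUnit H) :
    ∃ (B : Matrix n n ℂ) (ε : n → ℂ), IsUnit B ∧ (∀ i, ε i = 1 ∨ ε i = -1) ∧
      Bᴴ * diagonal ε * B = H := by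
  have hne : ∀ i, hH.eigenvalues i ≠ 0 := by
    have := (isUnit_iff_isUnit_det _).1 hu |>.ne_zero
    rw [hH.det_eq_prod_eigenvalues, Finset.prod_ne_zero_iff] at this
    intro i
    simpa using this i
  let S : Matrix n n ℂ := diagonal fun i => ((√|hH.eigenvalues i| : ℝ) : ℂ)
  let U : Matrix n n ℂ := hH.eigenvectorUnitary
  refine ⟨S * Uᴴ, fun i => ((SignType.sign (hH.eigenvalues i) : ℝ) : ℂ), ?_, fun i => ?_, ?_⟩
  · refine IsUnit.mul ?_ (Unitary.isUnit_coe (U := star hH.eigenvectorUnitary))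
    rw [isUnit_iff_isUnit_det]
    simp [S, Finset.prod_ne_zero_iff, hne]
  · rcases (hne i).lt_or_gt with h | h <;> simp [h]
  · have hSU : Sᴴ * diagonal (fun i => ((SignType.sign (hH.eigenvalues i) : ℝ) : ℂ)) * S =
        diagonal (RCLike.ofReal ∘ hH.eigenvalues) := by
      simp only [S, diagonal_conjTranspose, diagonal_mul_diagonal]
      congr 1
      ext i
      simp only [Pi.star_apply, Complex.star_def, Complex.conj_ofReal, Function.comp_apply]
      rw [mul_right_comm, ← Complex.ofReal_mul, Real.mul_self_sqrt (abs_nonneg _),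
        ← Complex.ofReal_mul, abs_mul_sign]
      rfl
    conv_rhs => rw [hH.spectral_theorem, Unitary.conjStarAlgAut_apply, ← hSU]
    simp [U, mul_assoc, star_eq_conjTranspose]

theorem Matrix.conjTranspose_mul_mul_conj_eq {n : Type*} [Fintype n] [DecidableEq n]
    {B E X : Matrix n n ℂ} (hB : IsUnit B) (h : Xᴴ * (Bᴴ * E * B) * X = Bᴴ * E * B) :
    (B * X * B⁻¹)ᴴ * E * (B * X * B⁻¹) = E := by
  have h1 : B * B⁻¹ = 1 := mul_nonsing_inv _ ((isUnit_iff_isUnit_det _).1 hB)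
  have h2 : B⁻¹ᴴ * Bᴴ = 1 := by rw [← conjTranspose_mul, h1, conjTranspose_one]
  calc (B * X * B⁻¹)ᴴ * E * (B * X * B⁻¹) = B⁻¹ᴴ * (Xᴴ * (Bᴴ * E * B) * X) * B⁻¹ := by
        simp only [conjTranspose_mul, mul_assoc]
    _ = (B⁻¹ᴴ * Bᴴ) * E * (B * B⁻¹) := by rw [h]; simp only [mul_assoc]
    _ = E := by rw [h1, h2, one_mul, mul_one]

/-- A matrix of determinant one preserving the Hermitian form `i J`, where `J` is the standard
symplectic form, is real. -/
theorem Matrix.im_eq_zero_of_conjTranspose_mul_mul_eq {X : Matrix (Fin 2) (Fin 2) ℂ}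
    (hdet : X.det = 1)
    (h : Xᴴ * !![0, Complex.I; -Complex.I, 0] * X = !![0, Complex.I; -Complex.I, 0])
    (i j : Fin 2) : (X i j).im = 0 := by
  have hX : X * X.adjugate = 1 := by rw [mul_adjugate, hdet, one_smul]
  have h' : Xᴴ * !![0, Complex.I; -Complex.I, 0] =
      !![0, Complex.I; -Complex.I, 0] * X.adjugate := by
    conv_rhs => rw [← h, mul_assoc, hX, mul_one]
  rw [← Complex.conj_eq_iff_im]
  have h00 := congr($h' 0 0)
  have h01 := congr($h' 0 1)
  have h10 := congr($h' 1 0)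
  have h11 := congr($h' 1 1)
  simp [Matrix.mul_apply, adjugate_fin_two, mul_comm Complex.I] at h00 h01 h10 h11
  fin_cases i <;> fin_cases j <;> simp_all

/-- A group of matrices of determinant one preserving a nondegenerate Hermitian form on `ℂ²` is
conjugate into `U(2)` or into the real matrices. -/
theorem Matrix.IsHermitian.exists_conj_mem_unitaryGroup_or_im_eq_zero
    {H : Matrix (Fin 2) (Fin 2) ℂ} (hH : H.IsHermitian) (hu : IsUnit H)
    {s : Set (Matrix (Fin 2) (Fin 2) ℂ)} (hdet : ∀ X ∈ s, X.det = 1)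
    (hs : ∀ X ∈ s, Xᴴ * H * X = H) :
    ∃ A : Matrix (Fin 2) (Fin 2) ℂ, IsUnit A ∧
      ((∀ X ∈ s, A * X * A⁻¹ ∈ unitaryGroup (Fin 2) ℂ) ∨
        ∀ X ∈ s, ∀ i j, ((A * X * A⁻¹) i j).im = 0) := by
  obtain ⟨B, ε, hB, hε, rfl⟩ := hH.exists_isUnit_conjTranspose_mul_diagonal_mul hu
  have hd : diagonal ε = !![ε 0, 0; 0, ε 1] := by
    ext i j; fin_cases i <;> fin_cases j <;> simp
  have definite : ∀ c : ℂ, c ≠ 0 → diagonal ε = c • 1 →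
      ∀ X ∈ s, B * X * B⁻¹ ∈ unitaryGroup (Fin 2) ℂ := fun c hc h X hX => by
    have := conjTranspose_mul_mul_conj_eq hB (hs X hX)
    rw [h, mul_smul_comm, mul_one, smul_mul_assoc] at this
    exact mem_unitaryGroup_iff'.2 (smul_right_injective _ hc this)
  have indefinite : ∀ C : Matrix (Fin 2) (Fin 2) ℂ, IsUnit C →
      Cᴴ * !![0, Complex.I; -Complex.I, 0] * C = (2 : ℂ) • diagonal ε →
      ∀ X ∈ s, ∀ i j, ((C * B * X * (C * B)⁻¹) i j).im = 0 := fun C hC h X hX => by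
    have hCB := hC.mul hB
    have hform : (C * B)ᴴ * !![0, Complex.I; -Complex.I, 0] * (C * B) =
        (2 : ℂ) • (Bᴴ * diagonal ε * B) := by
      rw [← smul_mul_assoc, ← mul_smul_comm, ← h, conjTranspose_mul]
      simp only [mul_assoc]
    refine im_eq_zero_of_conjTranspose_mul_mul_eq ?_ (conjTranspose_mul_mul_conj_eq hCB ?_)
    · rw [det_conj hCB, hdet X hX]
    · rw [hform, mul_smul_comm, smul_mul_assoc, hs X hX]
  rcases hε 0 with h0 | h0 <;> rcases hε 1 with h1 | h1
  · exact ⟨B, hB, .inl <| definite 1 one_ne_zero <| by rw [hd, h0, h1, one_fin_two]; simp⟩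
  · have hC : IsUnit !![Complex.I, -Complex.I; 1, 1] := by
      simp [isUnit_iff_isUnit_det, det_fin_two]
    refine ⟨_, hC.mul hB, .inr <| indefinite _ hC ?_⟩
    rw [hd, h0, h1]
    ext i j; fin_cases i <;> fin_cases j <;> simp [mul_apply] <;> norm_num
  · have hC : IsUnit !![-Complex.I, Complex.I; 1, 1] := by
      simp [isUnit_iff_isUnit_det, det_fin_two, ← neg_add']
    refine ⟨_, hC.mul hB, .inr <| indefinite _ hC ?_⟩
    rw [hd, h0, h1]
    ext i j; fin_cases i <;> fin_cases j <;> simp [mul_apply] <;> norm_num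
  · exact ⟨B, hB, .inl <| definite (-1) (by simp) <| by rw [hd, h0, h1, one_fin_two]; simp⟩

/-- If the irreducible representation `ρ` on `ℂⁿ` preserves a nondegenerate sesquilinear form, it
preserves a nondegenerate Hermitian form. -/
theorem Matrix.exists_isHermitian_of_forall_conjTranspose_mul_mul_eq {n : Type*} [Fintype n]
    [DecidableEq n] [Nonempty n] {G : Type*} [Group G] {ρ : G →* Matrix n n ℂ}
    (hρ : Function.Surjective (MonoidAlgebra.lift ℂ (Matrix n n ℂ) G ρ))
    {P : Matrix n n ℂ} (hP : IsUnit P) (h : ∀ x, (ρ x)ᴴ * P * ρ x = P) :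
    ∃ H : Matrix n n ℂ, H.IsHermitian ∧ IsUnit H ∧ ∀ x, (ρ x)ᴴ * H * ρ x = H := by
  have h' : ∀ x, (ρ x)ᴴ * Pᴴ * ρ x = Pᴴ := fun x => by
    simpa [mul_assoc] using congr($(h x)ᴴ)
  obtain ⟨H, hH, hne, hinv⟩ : ∃ H : Matrix n n ℂ, H.IsHermitian ∧ H ≠ 0 ∧
      ∀ x, (ρ x)ᴴ * H * ρ x = H := by
    by_cases hz : P + Pᴴ = 0
    · refine ⟨Complex.I • P, ?_, by simpa using hP.ne_zero, fun x => by simp [h]⟩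
      rw [IsHermitian, conjTranspose_smul, eq_neg_of_add_eq_zero_right hz]
      simp
    · exact ⟨_, isHermitian_add_transpose_self P, hz, fun x => by simp [mul_add, add_mul, h, h']⟩
  refine ⟨H, hH, ?_, hinv⟩
  have hPd := (isUnit_iff_isUnit_det _).1 hP
  have hcomm : ∀ x, Commute (ρ x) (P⁻¹ * H) := fun x => by
    have hu : IsUnit (ρ x)ᴴ := ((Group.isUnit x).map ρ).star
    have e : P * (ρ x * (P⁻¹ * H)) = H * ρ x := by
      apply hu.mul_left_cancel
      rw [← mul_assoc, ← mul_assoc, h, ← mul_assoc, mul_nonsing_inv _ hPd, one_mul,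
        ← mul_assoc, hinv]
    apply hP.mul_left_cancel
    rw [e, ← mul_assoc, ← mul_assoc, mul_nonsing_inv _ hPd, one_mul]
  have hcomm' : ∀ M, Commute M (P⁻¹ * H) := fun M => by
    obtain ⟨a, rfl⟩ := hρ M
    induction a using MonoidAlgebra.induction_on with
    | of x => simpa using hcomm x
    | add a b ha hb => simpa using ha.add_left hb
    | smul c a ha => simpa using ha.smul_left c
  obtain ⟨c, hc⟩ := mem_range_scalar_iff_commute_single'.2 fun i j => hcomm' (single i j 1)
  have hHc : H = P * scalar n c := by
    rw [hc, ← mul_assoc, mul_nonsing_inv _ hPd, one_mul]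
  have hc0 : c ≠ 0 := by
    rintro rfl
    exact hne (by simpa using hHc)
  rw [hHc]
  exact hP.mul ((IsUnit.mk0 c hc0).map (scalar n))

end


/-- Morgan–Shalen, Proposition III.1.1: if `φ : G → SL(2, ℂ)` is an irreducible
representation (no one-dimensional complex subspace of `ℂ²` is invariant under every
`φ(g)`) all of whose traces are real, then `φ` is conjugate into `SU(2)` or into
`SL(2, ℝ)`. -/
theorem irreducible_real_traces_conj_su2_or_sl2r
    (G : Type*) [Group G] (φ : G →* Matrix.SpecialLinearGroup (Fin 2) ℂ)
    (hirr : ¬ ∃ V : Submodule ℂ (Fin 2 → ℂ), Module.finrank ℂ V = 1 ∧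
      ∀ x : G, ∀ v ∈ V, Matrix.mulVec ((φ x : Matrix (Fin 2) (Fin 2) ℂ)) v ∈ V)
    (htr : ∀ x : G, (Matrix.trace (φ x : Matrix (Fin 2) (Fin 2) ℂ)).im = 0) :
    ∃ A : Matrix (Fin 2) (Fin 2) ℂ, IsUnit A ∧
      ((∀ x : G, A * (φ x : Matrix (Fin 2) (Fin 2) ℂ) * A⁻¹ ∈
          Matrix.unitaryGroup (Fin 2) ℂ) ∨
       (∀ x : G, ∀ i j : Fin 2,
          ((A * (φ x : Matrix (Fin 2) (Fin 2) ℂ) * A⁻¹) i j).im = 0)) := by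
  let ρ : G →* Matrix (Fin 2) (Fin 2) ℂ := Matrix.SpecialLinearGroup.coeMonoidHom.comp φ
  let ρ' : G →* Matrix (Fin 2) (Fin 2) ℂ :=
    { toFun := fun x => (ρ x⁻¹).conjTranspose
      map_one' := by simp
      map_mul' := fun x y => by simp }
  let τ : Representation ℂ G (Fin 2 → ℂ) := Matrix.toLinAlgEquiv'.toMonoidHom.comp ρ
  have hτ : τ.IsIrreducible := Representation.isIrreducible_of_finrank_eq_two (by simp)
    fun V hV hinv => hirr ⟨V, hV, hinv⟩
  have hsurj : Function.Surjective (MonoidAlgebra.lift ℂ (Matrix (Fin 2) (Fin 2) ℂ) G ρ) := by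
    have h : τ.asAlgebraHom = Matrix.toLinAlgEquiv'.toAlgHom.comp (MonoidAlgebra.lift ℂ _ G ρ) := by
      apply MonoidAlgebra.algHom_ext
      · intro x
        simp [τ]
      · exact Subsingleton.elim _ _
    have := Representation.IsIrreducible.asAlgebraHom_surjective τ
    rw [h] at this
    exact (Function.Surjective.of_comp_iff' Matrix.toLinAlgEquiv'.bijective _).1 this
  have htrace : ∀ a, (MonoidAlgebra.lift ℂ _ G ρ a).trace =
      (MonoidAlgebra.lift ℂ _ G ρ' a).trace := fun a => by
    induction a using MonoidAlgebra.induction_on with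
    | of x =>
      have hinv : (ρ' x).trace = starRingEnd ℂ (φ x : Matrix (Fin 2) (Fin 2) ℂ).trace := by
        simp [ρ', ρ, Matrix.SpecialLinearGroup.coe_inv, Matrix.adjugate_fin_two,
          Matrix.trace_fin_two, add_comm]
      simp [hinv, Complex.conj_eq_iff_im.2 (htr x), ρ]
    | add a b ha hb => simp [ha, hb]
    | smul c a ha => simp [ha]
  obtain ⟨P, hP, hPρ⟩ := AlgHom.exists_isUnit_intertwining_of_trace_eq _ _ hsurj htrace
  have hform : ∀ x, (ρ x).conjTranspose * P * ρ x = P := fun x => by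
    have h : P * ρ x = ρ' x * P := by simpa using hPρ (MonoidAlgebra.of ℂ G x)
    rw [mul_assoc, h, ← mul_assoc]
    simp [ρ', ← Matrix.conjTranspose_mul, ← map_mul]
  obtain ⟨H, hH, hu, hHρ⟩ :=
    Matrix.exists_isHermitian_of_forall_conjTranspose_mul_mul_eq hsurj hP hform
  simpa using! hH.exists_conj_mem_unitaryGroup_or_im_eq_zero hu (s := Set.range ρ)
    (by rintro _ ⟨x, rfl⟩; exact (φ x).2) (by rintro _ ⟨x, rfl⟩; exact hHρ x)
end

section
/- Let G be a subgroup of SL(2,ℂ) such that: (i) G is irreducible, i.e., no one-dimensional complex linear subspace of ℂ² is invariant under every element of G; (ii) G is discrete, i.e., the subspace topology on G induced from SL(2,ℂ) is discrete; (iii) G is torsion-free, i.e., its only element of finite order is the identity; and (iv) every element of G has real trace. Then G is conjugate into SL(2,ℝ): there exists an invertible 2×2 complex matrix A such that A·g·A⁻¹ has all entries real for every g ∈ G. -/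
/-- The topology on `SL(2, ℂ)` induced from the space of `2 × 2` complex matrices. -/
noncomputable instance : TopologicalSpace (Matrix.SpecialLinearGroup (Fin 2) ℂ) :=
  TopologicalSpace.induced
    (fun g : Matrix.SpecialLinearGroup (Fin 2) ℂ => (g : Matrix (Fin 2) (Fin 2) ℂ))
    inferInstance

section

open Matrix Filter Topology

/-- For an irreducible `G`, no off-diagonal entry vanishes identically in any basis. -/
theorem exists_conj_apply_ne_zero_of_irreducible
    {G : Subgroup (Matrix.SpecialLinearGroup (Fin 2) ℂ)}
    (hirr : ¬ ∃ V : Submodule ℂ (Fin 2 → ℂ), Module.finrank ℂ V = 1 ∧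
      ∀ g ∈ G, ∀ v ∈ V, (g : Matrix (Fin 2) (Fin 2) ℂ) *ᵥ v ∈ V)
    {P : Matrix (Fin 2) (Fin 2) ℂ} (hP : IsUnit P) {i j : Fin 2} (hij : i ≠ j) :
    ∃ g ∈ G, (P⁻¹ * (g : Matrix (Fin 2) (Fin 2) ℂ) * P) i j ≠ 0 := by
  by_contra! h
  have hdet : IsUnit P.det := (isUnit_iff_isUnit_det P).1 hP
  have hne : P *ᵥ Pi.single j 1 ≠ 0 := fun h0 => by
    have h1 := congrArg (P⁻¹ *ᵥ ·) h0
    simp only [mulVec_mulVec, nonsing_inv_mul P hdet, one_mulVec, mulVec_zero] at h1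
    simpa using congrFun h1 j
  refine hirr ⟨ℂ ∙ (P *ᵥ Pi.single j 1), finrank_span_singleton hne, fun g hg v hv => ?_⟩
  obtain ⟨c, rfl⟩ := Submodule.mem_span_singleton.1 hv
  rw [mulVec_smul]
  refine Submodule.smul_mem _ _ (Submodule.mem_span_singleton.2
    ⟨(P⁻¹ * (g : Matrix (Fin 2) (Fin 2) ℂ) * P) j j, ?_⟩)
  have hcol : (P⁻¹ * (g : Matrix (Fin 2) (Fin 2) ℂ) * P) *ᵥ Pi.single j 1 =
      (P⁻¹ * (g : Matrix (Fin 2) (Fin 2) ℂ) * P) j j • Pi.single j 1 := by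
    ext k
    by_cases hk : k = j
    · subst hk; simp
    · obtain rfl : k = i := by omega
      simp [h g hg, hk]
  rw [← mulVec_smul, ← hcol, mulVec_mulVec, mulVec_mulVec, ← mul_assoc,
    mul_nonsing_inv_cancel_left _ _ hdet]

/-- A multiplicatively closed set of matrices with real traces that contains a real diagonal
matrix with distinct eigenvalues and is not triangular can be conjugated by a diagonal matrix to
consist of real matrices. -/
theorem exists_conj_real_of_diagonal_mem {S : Set (Matrix (Fin 2) (Fin 2) ℂ)}
    (hmul : ∀ g ∈ S, ∀ h ∈ S, g * h ∈ S) (htr : ∀ g ∈ S, (trace g).im = 0)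
    {x y : ℝ} (hxy : x ≠ y) (hmem : !![(x : ℂ), 0; 0, (y : ℂ)] ∈ S)
    (h01 : ∃ g ∈ S, g 0 1 ≠ 0) (h10 : ∃ g ∈ S, g 1 0 ≠ 0) :
    ∃ D : Matrix (Fin 2) (Fin 2) ℂ, IsUnit D ∧ ∀ g ∈ S, ∀ i j, ((D * g * D⁻¹) i j).im = 0 := by
  have hdiag : ∀ g ∈ S, (g 0 0).im = 0 ∧ (g 1 1).im = 0 := fun g hg => by
    have h1 := htr g hg
    have h2 := htr _ (hmul _ hmem g hg)
    simp only [trace_fin_two, mul_apply, Fin.sum_univ_two, of_apply, cons_val', cons_val_zero,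
      cons_val_one, cons_val_fin_one, zero_mul, add_zero, zero_add, Complex.add_im,
      Complex.im_ofReal_mul] at h1 h2
    have h3 : (x - y) * (g 0 0).im = 0 := by linear_combination h2 - y * h1
    have h4 := (mul_eq_zero.1 h3).resolve_left (sub_ne_zero.2 hxy)
    exact ⟨h4, by linarith⟩
  have hoff : ∀ g ∈ S, ∀ h ∈ S, (g 0 1 * h 1 0).im = 0 := fun g hg h hh => by
    have h1 := (hdiag _ (hmul g hg h hh)).1
    rw [mul_apply, Fin.sum_univ_two, Complex.add_im, Complex.mul_im, (hdiag g hg).1,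
      (hdiag h hh).1] at h1
    simpa using h1
  obtain ⟨p, hp, hp0⟩ := h01
  obtain ⟨q, hq, hq0⟩ := h10
  have hdet : IsUnit (!![q 1 0, 0; 0, 1] : Matrix (Fin 2) (Fin 2) ℂ).det := by simpa using hq0
  have hinv : (!![q 1 0, 0; 0, 1] : Matrix (Fin 2) (Fin 2) ℂ)⁻¹ = !![(q 1 0)⁻¹, 0; 0, 1] :=
    inv_eq_right_inv (by simp [hq0, one_fin_two])
  refine ⟨!![q 1 0, 0; 0, 1], (isUnit_iff_isUnit_det _).2 hdet, fun g hg i j => ?_⟩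
  rw [hinv, eta_fin_two g, mul_fin_two, mul_fin_two]
  fin_cases i <;> fin_cases j
  · simpa [mul_right_comm _ (g 0 0), hq0] using (hdiag g hg).1
  · simpa [mul_comm] using hoff g hg q hq
  · have h1 : g 1 0 * (q 1 0)⁻¹ = (p 0 1 * g 1 0) / (p 0 1 * q 1 0) := by field_simp
    have h2 := hoff p hp g hg
    have h3 := hoff p hp q hq
    simp [h1, Complex.div_im, h2, h3]
  · simpa using (hdiag g hg).2

/-- A `2 × 2` matrix whose characteristic polynomial has distinct roots is diagonalizable. -/
theorem exists_conj_eq_diagonal {K : Type*} [Field K] {M : Matrix (Fin 2) (Fin 2) K} {x y : K}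
    (hxy : x ≠ y) (htr : trace M = x + y) (hdet : M.det = x * y) :
    ∃ P : Matrix (Fin 2) (Fin 2) K, IsUnit P ∧ P⁻¹ * M * P = !![x, 0; 0, y] := by
  rw [trace_fin_two] at htr
  rw [det_fin_two] at hdet
  have key : ∀ z, (z - x) * (z - y) = 0 → ∃ v : Fin 2 → K, v ≠ 0 ∧
      M 0 0 * v 0 + M 0 1 * v 1 = z * v 0 ∧ M 1 0 * v 0 + M 1 1 * v 1 = z * v 1 := fun z hz => by
    have h0 : (!![M 0 0 - z, M 0 1; M 1 0, M 1 1 - z] : Matrix (Fin 2) (Fin 2) K).det = 0 := by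
      rw [det_fin_two_of]
      linear_combination hdet - z * htr + hz
    obtain ⟨v, hv, hv0⟩ := exists_mulVec_eq_zero_iff.2 h0
    have e0 := congrFun hv0 0
    have e1 := congrFun hv0 1
    simp [mulVec, dotProduct, Fin.sum_univ_two] at e0 e1
    exact ⟨v, hv, by linear_combination e0, by linear_combination e1⟩
  obtain ⟨v, hv, v0, v1⟩ := key x (by simp)
  obtain ⟨w, hw, w0, w1⟩ := key y (by simp)
  have hxy' := sub_ne_zero.2 hxy
  have hP : (!![v 0, w 0; v 1, w 1] : Matrix (Fin 2) (Fin 2) K).det ≠ 0 := fun h => by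
    rw [det_fin_two_of] at h
    have hz : ∀ i j, v i * w j = 0 := fun i j => by
      refine (mul_eq_zero.1 (?_ : (x - y) * (v i * w j) = 0)).resolve_left hxy'
      fin_cases i <;> fin_cases j <;> simp only [Fin.zero_eta, Fin.mk_one]
      · linear_combination (-w 0) * v0 + v 0 * w0 - M 0 1 * h
      · linear_combination x * h - w 0 * v1 + v 0 * w1 - M 1 1 * h
      · linear_combination (-w 0) * v1 + v 0 * w1 - M 1 1 * h + y * h
      · linear_combination (-w 1) * v1 + v 1 * w1 + M 1 0 * h
    obtain ⟨i, hi⟩ := Function.ne_iff.1 hv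
    obtain ⟨j, hj⟩ := Function.ne_iff.1 hw
    exact mul_ne_zero hi hj (hz i j)
  have hu : IsUnit (!![v 0, w 0; v 1, w 1] : Matrix (Fin 2) (Fin 2) K).det := hP.isUnit
  refine ⟨!![v 0, w 0; v 1, w 1], (isUnit_iff_isUnit_det _).2 hu, ?_⟩
  have : M * !![v 0, w 0; v 1, w 1] = !![v 0, w 0; v 1, w 1] * !![x, 0; 0, y] := by
    rw [eta_fin_two M, mul_fin_two, mul_fin_two]
    simp [v0, v1, w0, w1, mul_comm x, mul_comm y]
  rw [mul_assoc, this, nonsing_inv_mul_cancel_left _ _ hu]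

/-- A non-scalar `2 × 2` matrix whose characteristic polynomial has a double root is conjugate
to a Jordan block. -/
theorem exists_conj_eq_jordan {K : Type*} [Field K] {M : Matrix (Fin 2) (Fin 2) K} {x : K}
    (hM : M ≠ x • 1) (htr : trace M = 2 * x) (hdet : M.det = x * x) :
    ∃ P : Matrix (Fin 2) (Fin 2) K, IsUnit P ∧ P⁻¹ * M * P = !![x, 1; 0, x] := by
  rw [trace_fin_two] at htr
  rw [det_fin_two] at hdet
  have key : ∀ w : Fin 2 → K, (M 0 0 * w 0 + M 0 1 * w 1 - x * w 0) * w 1 -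
      (M 1 0 * w 0 + M 1 1 * w 1 - x * w 1) * w 0 ≠ 0 → ∃ P : Matrix (Fin 2) (Fin 2) K,
      IsUnit P ∧ P⁻¹ * M * P = !![x, 1; 0, x] := fun w hw => by
    set v0 := M 0 0 * w 0 + M 0 1 * w 1 - x * w 0 with hv0
    set v1 := M 1 0 * w 0 + M 1 1 * w 1 - x * w 1 with hv1
    have hu : IsUnit (!![v0, w 0; v1, w 1] : Matrix (Fin 2) (Fin 2) K).det := by
      rw [det_fin_two_of, mul_comm (w 0)]; exact hw.isUnit
    refine ⟨!![v0, w 0; v1, w 1], (isUnit_iff_isUnit_det _).2 hu, ?_⟩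
    have : M * !![v0, w 0; v1, w 1] = !![v0, w 0; v1, w 1] * !![x, 1; 0, x] := by
      rw [eta_fin_two M, mul_fin_two, mul_fin_two]
      ext i j
      fin_cases i <;> fin_cases j <;> simp [hv0, hv1]
      · linear_combination (M 0 0 * w 0 + M 0 1 * w 1) * htr - w 0 * hdet
      · ring
      · linear_combination (M 1 0 * w 0 + M 1 1 * w 1) * htr - w 1 * hdet
      · ring
    rw [mul_assoc, this, nonsing_inv_mul_cancel_left _ _ hu]
  by_cases h10 : M 1 0 = 0
  · by_cases h01 : M 0 1 = 0
    · refine absurd ?_ hM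
      have h00 : M 0 0 = x := by
        have : (M 0 0 - x) ^ 2 = 0 := by
          linear_combination M 0 0 * htr - hdet - M 0 1 * h10
        exact sub_eq_zero.1 (pow_eq_zero_iff two_ne_zero |>.1 this)
      have h11 : M 1 1 = x := by linear_combination htr - h00
      rw [eta_fin_two M, h00, h01, h10, h11]
      simp [one_fin_two, smul_of]
    · exact key ![0, 1] (by simpa using h01)
  · exact key ![1, 0] (by simpa using h10)

/-- In a discrete subgroup of `SL(2, ℂ)`, an element with real trace in `(-2, 2)` has finite
order. -/
theorem isOfFinOrder_of_discrete_of_abs_trace_lt_two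
    {G : Subgroup (Matrix.SpecialLinearGroup (Fin 2) ℂ)} (hdisc : DiscreteTopology G)
    {g : Matrix.SpecialLinearGroup (Fin 2) ℂ} (hg : g ∈ G) {t : ℝ}
    (htr : trace (g : Matrix (Fin 2) (Fin 2) ℂ) = t) (ht : |t| < 2) : IsOfFinOrder g := by
  have ht2 : 0 < 4 - t ^ 2 := by nlinarith [abs_lt.1 ht]
  obtain ⟨s, hs0, hs⟩ : ∃ s : ℝ, 0 < s ∧ s ^ 2 = 4 - t ^ 2 :=
    ⟨√(4 - t ^ 2), Real.sqrt_pos.2 ht2, Real.sq_sqrt ht2.le⟩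
  have hnorm : ‖(⟨t / 2, s / 2⟩ : ℂ)‖ = 1 := by
    rw [← sq_eq_sq₀ (norm_nonneg _) zero_le_one, ← Complex.normSq_eq_norm_sq, Complex.normSq_mk]
    linarith
  obtain ⟨z, hz⟩ : ∃ z : Circle, (z : ℂ) = ⟨t / 2, s / 2⟩ :=
    ⟨⟨_, mem_sphere_zero_iff_norm.2 hnorm⟩, rfl⟩
  have hzinv : ((z⁻¹ : Circle) : ℂ) = ⟨t / 2, -(s / 2)⟩ := by
    rw [Circle.coe_inv_eq_conj, hz]; rfl
  obtain ⟨P, hP, hPg⟩ := exists_conj_eq_diagonal (M := (g : Matrix (Fin 2) (Fin 2) ℂ))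
    (x := (z : ℂ)) (y := ((z⁻¹ : Circle) : ℂ))
    (by rw [hz, hzinv]; intro h; have := congrArg Complex.im h; simp at this; linarith)
    (by rw [htr, hz, hzinv]; apply Complex.ext <;> simp)
    (by rw [g.det_coe, ← Circle.coe_mul]; simp)
  have hu : IsUnit P.det := (isUnit_iff_isUnit_det P).1 hP
  let f : Circle → Matrix (Fin 2) (Fin 2) ℂ :=
    fun w => P * !![(w : ℂ), 0; 0, ((w⁻¹ : Circle) : ℂ)] * P⁻¹
  have hf1 : f 1 = 1 := by
    simp [f, ← one_fin_two, mul_nonsing_inv P hu]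
  have hfpow : ∀ n : ℕ, f (z ^ n) = (g : Matrix (Fin 2) (Fin 2) ℂ) ^ n := fun n => by
    induction n with
    | zero => simpa using hf1
    | succ n ih =>
      have hgz : (g : Matrix (Fin 2) (Fin 2) ℂ) =
          P * !![(z : ℂ), 0; 0, ((z⁻¹ : Circle) : ℂ)] * P⁻¹ := by
        rw [← hPg, mul_assoc P⁻¹, mul_nonsing_inv_cancel_left _ _ hu,
          mul_nonsing_inv_cancel_right _ _ hu]
      have hD : (!![((z ^ (n + 1) : Circle) : ℂ), 0; 0, (((z ^ (n + 1))⁻¹ : Circle) : ℂ)] :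
          Matrix (Fin 2) (Fin 2) ℂ) = !![((z ^ n : Circle) : ℂ), 0; 0, (((z ^ n)⁻¹ : Circle) : ℂ)] *
            !![(z : ℂ), 0; 0, ((z⁻¹ : Circle) : ℂ)] := by
        rw [mul_fin_two]
        simp [pow_succ, mul_comm]
      rw [pow_succ (g : Matrix (Fin 2) (Fin 2) ℂ), ← ih]
      conv_rhs => rw [hgz]
      simp only [f, hD, mul_assoc, nonsing_inv_mul_cancel_left _ _ hu]
  have hfc : Continuous f := by
    refine (continuous_const.matrix_mul ?_).matrix_mul continuous_const
    refine continuous_matrix fun i j => ?_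
    fin_cases i <;> fin_cases j <;> simp [-Circle.coe_inv] <;> fun_prop
  obtain ⟨U, hU, hUG⟩ : ∃ U ∈ 𝓝 (1 : Matrix (Fin 2) (Fin 2) ℂ),
      ∀ h ∈ G, (h : Matrix (Fin 2) (Fin 2) ℂ) ∈ U → h = 1 := by
    have h1 : ({1} : Set G) ∈ 𝓝 (1 : G) := (isOpen_discrete _).mem_nhds rfl
    have h2 : 𝓝 (1 : Matrix.SpecialLinearGroup (Fin 2) ℂ) =
        comap (fun h : Matrix.SpecialLinearGroup (Fin 2) ℂ => (h : Matrix (Fin 2) (Fin 2) ℂ))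
          (𝓝 (1 : Matrix (Fin 2) (Fin 2) ℂ)) :=
      nhds_induced _ _
    rw [nhds_subtype_eq_comap, OneMemClass.coe_one, h2, comap_comap] at h1
    obtain ⟨U, hU, hUG⟩ := mem_comap.1 h1
    exact ⟨U, hU, fun h hh hhU => congrArg Subtype.val
      (hUG (show (⟨h, hh⟩ : G) ∈ _ from hhU))⟩
  have hev : ∀ᶠ w in 𝓝 (1 : Circle), f w ∈ U := hfc.continuousAt.eventually (by rwa [hf1])
  obtain ⟨n, hn, hn0⟩ := ((mapClusterPt_iff_frequently.1 (mapClusterPt_one_atTop_pow z)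
    _ hev).and_eventually (eventually_gt_atTop 0)).exists
  refine isOfFinOrder_iff_pow_eq_one.2 ⟨n, hn0, hUG _ (pow_mem hg n) ?_⟩
  rw [Matrix.SpecialLinearGroup.coe_pow, ← hfpow]
  exact hn

/-- Conjugacy into `SL(2, ℝ)` for an irreducible group with real traces containing an element
of trace outside `[-2, 2]`. -/
theorem exists_conj_real_of_two_lt_abs_trace
    {G : Subgroup (Matrix.SpecialLinearGroup (Fin 2) ℂ)}
    (hirr : ¬ ∃ V : Submodule ℂ (Fin 2 → ℂ), Module.finrank ℂ V = 1 ∧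
      ∀ g ∈ G, ∀ v ∈ V, (g : Matrix (Fin 2) (Fin 2) ℂ) *ᵥ v ∈ V)
    (htr : ∀ g ∈ G, (trace (g : Matrix (Fin 2) (Fin 2) ℂ)).im = 0)
    {g : Matrix.SpecialLinearGroup (Fin 2) ℂ} (hg : g ∈ G)
    (ht : 2 < |(trace (g : Matrix (Fin 2) (Fin 2) ℂ)).re|) :
    ∃ A : Matrix (Fin 2) (Fin 2) ℂ, IsUnit A ∧
      ∀ g ∈ G, ∀ i j : Fin 2, ((A * (g : Matrix (Fin 2) (Fin 2) ℂ) * A⁻¹) i j).im = 0 := by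
  obtain ⟨t, htg⟩ : ∃ t : ℝ, trace (g : Matrix (Fin 2) (Fin 2) ℂ) = t :=
    ⟨_, Complex.ext rfl (htr g hg)⟩
  rw [htg, Complex.ofReal_re] at ht
  have ht2 : 0 < t ^ 2 - 4 := by nlinarith [sq_abs t]
  obtain ⟨s, hs0, hs⟩ : ∃ s : ℝ, 0 < s ∧ s ^ 2 = t ^ 2 - 4 :=
    ⟨√(t ^ 2 - 4), Real.sqrt_pos.2 ht2, Real.sq_sqrt ht2.le⟩
  have hxy : (t + s) / 2 ≠ (t - s) / 2 := by intro h; linarith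
  obtain ⟨P, hP, hPg⟩ := exists_conj_eq_diagonal (M := (g : Matrix (Fin 2) (Fin 2) ℂ))
    (x := (((t + s) / 2 : ℝ) : ℂ)) (y := (((t - s) / 2 : ℝ) : ℂ))
    (by exact_mod_cast hxy) (by rw [htg]; push_cast; ring)
    (by rw [g.det_coe, ← Complex.ofReal_mul, ← Complex.ofReal_one]; congr 1; linarith)
  have hu : IsUnit P.det := (isUnit_iff_isUnit_det P).1 hP
  obtain ⟨p, hp, hp0⟩ := exists_conj_apply_ne_zero_of_irreducible hirr hP zero_ne_one
  obtain ⟨q, hq, hq0⟩ := exists_conj_apply_ne_zero_of_irreducible hirr hP one_ne_zero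
  obtain ⟨D, hD, hreal⟩ := exists_conj_real_of_diagonal_mem
    (S := {M | ∃ h ∈ G, P⁻¹ * (h : Matrix (Fin 2) (Fin 2) ℂ) * P = M})
    (by
      rintro _ ⟨h, hh, rfl⟩ _ ⟨k, hk, rfl⟩
      refine ⟨h * k, mul_mem hh hk, ?_⟩
      simp only [Matrix.SpecialLinearGroup.coe_mul, mul_assoc, mul_nonsing_inv_cancel_left _ _ hu])
    (by
      rintro _ ⟨h, hh, rfl⟩
      rw [trace_mul_comm, mul_nonsing_inv_cancel_left _ _ hu]
      exact htr h hh)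
    hxy ⟨g, hg, hPg⟩ ⟨_, ⟨p, hp, rfl⟩, hp0⟩ ⟨_, ⟨q, hq, rfl⟩, hq0⟩
  refine ⟨D * P⁻¹, hD.mul ((isUnit_nonsing_inv_iff).2 hP), fun h hh i j => ?_⟩
  rw [Matrix.mul_inv_rev, nonsing_inv_nonsing_inv _ hu]
  simpa only [mul_assoc] using hreal _ ⟨h, hh, rfl⟩ i j

/-- An irreducible group with real traces containing a parabolic element contains an element of
trace outside `[-2, 2]`. -/
theorem exists_two_lt_abs_trace_of_jordan
    {G : Subgroup (Matrix.SpecialLinearGroup (Fin 2) ℂ)}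
    (hirr : ¬ ∃ V : Submodule ℂ (Fin 2 → ℂ), Module.finrank ℂ V = 1 ∧
      ∀ g ∈ G, ∀ v ∈ V, (g : Matrix (Fin 2) (Fin 2) ℂ) *ᵥ v ∈ V)
    (htr : ∀ g ∈ G, (trace (g : Matrix (Fin 2) (Fin 2) ℂ)).im = 0)
    {g : Matrix.SpecialLinearGroup (Fin 2) ℂ} (hg : g ∈ G) {P : Matrix (Fin 2) (Fin 2) ℂ}
    (hP : IsUnit P) {x : ℝ} (hx : x ^ 2 = 1)
    (hPg : P⁻¹ * (g : Matrix (Fin 2) (Fin 2) ℂ) * P = !![(x : ℂ), 1; 0, (x : ℂ)]) :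
    ∃ h ∈ G, 2 < |(trace (h : Matrix (Fin 2) (Fin 2) ℂ)).re| := by
  have hu : IsUnit P.det := (isUnit_iff_isUnit_det P).1 hP
  obtain ⟨h, hh, hc⟩ := exists_conj_apply_ne_zero_of_irreducible hirr hP one_ne_zero
  set X := P⁻¹ * (h : Matrix (Fin 2) (Fin 2) ℂ) * P with hX
  have hxC : (x : ℂ) * x = 1 := by rw [← sq]; exact_mod_cast hx
  have hpow : ∀ n : ℕ, P⁻¹ * (g : Matrix (Fin 2) (Fin 2) ℂ) ^ (2 * n) * P =
      !![1, 2 * n * (x : ℂ); 0, 1] := fun n => by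
    induction n with
    | zero => simp [nonsing_inv_mul P hu, ← one_fin_two]
    | succ n ih =>
      calc P⁻¹ * (g : Matrix (Fin 2) (Fin 2) ℂ) ^ (2 * (n + 1)) * P
          = (P⁻¹ * (g : Matrix (Fin 2) (Fin 2) ℂ) ^ (2 * n) * P) *
            ((P⁻¹ * (g : Matrix (Fin 2) (Fin 2) ℂ) * P) *
              (P⁻¹ * (g : Matrix (Fin 2) (Fin 2) ℂ) * P)) := by
            simp only [mul_assoc, mul_nonsing_inv_cancel_left _ _ hu, mul_add, mul_one, pow_add,
              pow_two]
        _ = _ := by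
            rw [ih, hPg, mul_fin_two, mul_fin_two]
            simp [hxC]
            ring
  have htrace : ∀ n : ℕ, trace ((g ^ (2 * n) * h : Matrix.SpecialLinearGroup (Fin 2) ℂ) :
      Matrix (Fin 2) (Fin 2) ℂ) = trace (h : Matrix (Fin 2) (Fin 2) ℂ) + 2 * n * x * X 1 0 :=
    fun n => by
      have htX : trace X = trace (h : Matrix (Fin 2) (Fin 2) ℂ) := by
        rw [hX, trace_mul_comm, mul_nonsing_inv_cancel_left _ _ hu]
      calc _ = trace (P⁻¹ * (g : Matrix (Fin 2) (Fin 2) ℂ) ^ (2 * n) * P * X) := by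
            rw [hX, mul_assoc P⁻¹, mul_assoc P⁻¹, trace_mul_comm]
            simp only [mul_assoc, mul_nonsing_inv_cancel_left _ _ hu, mul_nonsing_inv P hu,
              mul_one, Matrix.SpecialLinearGroup.coe_mul, Matrix.SpecialLinearGroup.coe_pow]
        _ = _ := by
            rw [hpow, ← htX, eta_fin_two X, mul_fin_two]
            simp [trace_fin_two]
            ring
  have hmem : ∀ n : ℕ, g ^ (2 * n) * h ∈ G := fun n => mul_mem (pow_mem hg _) hh
  have hx0 : x ≠ 0 := fun h0 => by simp [h0] at hx
  have hre : ∀ n : ℕ, (trace ((g ^ (2 * n) * h : Matrix.SpecialLinearGroup (Fin 2) ℂ) :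
      Matrix (Fin 2) (Fin 2) ℂ)).re =
      (trace (h : Matrix (Fin 2) (Fin 2) ℂ)).re + n * (2 * (x * (X 1 0).re)) := fun n => by
    rw [htrace]
    simp
    ring
  have him : (X 1 0).im = 0 := by
    have := htr _ (hmem 1)
    rw [htrace] at this
    simpa [htr h hh, hx0] using this
  have hc0 : 0 < |2 * (x * (X 1 0).re)| :=
    abs_pos.2 (mul_ne_zero two_ne_zero (mul_ne_zero hx0 fun h0 => hc (Complex.ext h0 him)))
  obtain ⟨n, hn⟩ := exists_nat_gt
    ((2 + |(trace (h : Matrix (Fin 2) (Fin 2) ℂ)).re|) / |2 * (x * (X 1 0).re)|)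
  rw [div_lt_iff₀ hc0] at hn
  refine ⟨_, hmem n, ?_⟩
  rw [hre]
  have h1 := abs_sub_abs_le_abs_add (n * (2 * (x * (X 1 0).re)))
    (trace (h : Matrix (Fin 2) (Fin 2) ℂ)).re
  rw [abs_mul, Nat.abs_cast, add_comm (n * _ : ℝ)] at h1
  linarith

end

/-- If `G ≤ SL(2, ℂ)` is irreducible (no one-dimensional complex subspace of `ℂ²` is
invariant under every element of `G`), discrete, torsion-free, and all of its elements have
real trace, then `G` is conjugate into `SL(2, ℝ)`: there is an invertible complex `2 × 2`
matrix `A` such that `A g A⁻¹` has all entries real for every `g ∈ G`. -/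
theorem discrete_torsionfree_real_traces_conj_into_SL2R
    (G : Subgroup (Matrix.SpecialLinearGroup (Fin 2) ℂ))
    (hirr : ¬ ∃ V : Submodule ℂ (Fin 2 → ℂ), Module.finrank ℂ V = 1 ∧
      ∀ g ∈ G, ∀ v ∈ V, Matrix.mulVec ((g : Matrix (Fin 2) (Fin 2) ℂ)) v ∈ V)
    (hdisc : DiscreteTopology G)
    (htf : ∀ g ∈ G, IsOfFinOrder g → g = 1)
    (htr : ∀ g ∈ G, (Matrix.trace ((g : Matrix (Fin 2) (Fin 2) ℂ))).im = 0) :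
    ∃ A : Matrix (Fin 2) (Fin 2) ℂ, IsUnit A ∧
      ∀ g ∈ G, ∀ i j : Fin 2,
        ((A * (g : Matrix (Fin 2) (Fin 2) ℂ) * A⁻¹) i j).im = 0 := by
  obtain ⟨g, hg, hg1⟩ : ∃ g ∈ G, g ≠ 1 := by
    obtain ⟨g, hg, hg0⟩ := exists_conj_apply_ne_zero_of_irreducible hirr isUnit_one zero_ne_one
    exact ⟨g, hg, by rintro rfl; simp at hg0⟩
  obtain ⟨t, htg⟩ : ∃ t : ℝ, Matrix.trace (g : Matrix (Fin 2) (Fin 2) ℂ) = t :=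
    ⟨_, Complex.ext rfl (htr g hg)⟩
  rcases lt_trichotomy |t| 2 with ht | ht | ht
  · exact absurd (htf g hg (isOfFinOrder_of_discrete_of_abs_trace_lt_two hdisc hg htg ht)) hg1
  · have hx : (t / 2) ^ 2 = 1 := by
      rw [div_pow, ← sq_abs, ht]; norm_num
    have hxC : ((t / 2 : ℝ) : ℂ) * ((t / 2 : ℝ) : ℂ) = 1 := by
      rw [← sq]; exact_mod_cast hx
    obtain ⟨P, hP, hPg⟩ := exists_conj_eq_jordan (M := (g : Matrix (Fin 2) (Fin 2) ℂ))
      (x := ((t / 2 : ℝ) : ℂ))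
      (fun h => hg1 (htf g hg (isOfFinOrder_iff_pow_eq_one.2 ⟨2, two_pos, Subtype.ext <| by
        rw [Matrix.SpecialLinearGroup.coe_pow, h, smul_pow, one_pow, sq, hxC, one_smul]; rfl⟩)))
      (by rw [htg]; push_cast; ring) (by rw [g.det_coe, hxC])
    obtain ⟨h, hh, hlt⟩ := exists_two_lt_abs_trace_of_jordan hirr htr hg hP hx hPg
    exact exists_conj_real_of_two_lt_abs_trace hirr htr hh hlt
  · exact exists_conj_real_of_two_lt_abs_trace hirr htr hg (by rwa [htg])
end
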